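/- arXiv:2209.03478 — 2 statements merged into one kernel-verified Lean document; each statement's English description precedes it below -/
import Mathlib

section
/- For every Q₁=(q₁,q₂,q₃), Q₂=(q₅,q₆,q₇) ∈ {0,1}³, every x⃗=(x₁,x₂,x₃) ∈ {0,1}³ of even Hamming weight, every sign s ∈ {+1,−1}, and all bits i,j,k ∈ {0,1} with i+j+k even, the 7-qubit vector v_{x⃗,s} satisfies (P_i ⊗ P_j ⊗ P_k ⊗ X ⊗ I ⊗ I ⊗ I) v_{x⃗,s} = s · (−1)^{x₂} · (√−1)^{i+j+k} · (−1)^{i q₁ + j q₂ + k q₃} · v_{x⃗,s}. (The sign (−1)^{x₂} reproduces exactly the four cases x⃗ = (0,0,0), (1,0,1), (0,1,1), (1,1,0) listed in the paper, with signs +, +, −, − respectively.) -/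
open Matrix Complex

noncomputable section

/-- Single-qubit Pauli X. -/
def Xg : Matrix (Fin 2) (Fin 2) ℂ := !![0, 1; 1, 0]
/-- Single-qubit Pauli Y. -/
def Yg : Matrix (Fin 2) (Fin 2) ℂ := !![0, -Complex.I; Complex.I, 0]
/-- Single-qubit Pauli Z. -/
def Zg : Matrix (Fin 2) (Fin 2) ℂ := !![1, 0; 0, -1]
/-- P₀ = X, P₁ = Y. -/
def Pg : Fin 2 → Matrix (Fin 2) (Fin 2) ℂ := fun i => if i = 0 then Xg else Yg

/-- Tensor (Kronecker) product of `n` single-qubit operators, as a matrix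
indexed by bit strings. -/
def tens {n : ℕ} (M : Fin n → Matrix (Fin 2) (Fin 2) ℂ) :
    Matrix (Fin n → Fin 2) (Fin n → Fin 2) ℂ :=
  Matrix.of fun r c => ∏ m, M m (r m) (c m)

/-- Computational basis vector |q⟩. -/
def ket {n : ℕ} (q : Fin n → Fin 2) : (Fin n → Fin 2) → ℂ :=
  fun r => if r = q then 1 else 0

/-- The eigenvector v_{x⃗,s} of the paper (7 qubits). -/
def vx (q₁ q₂ q₃ q₅ q₆ q₇ x₁ x₂ x₃ : Fin 2) (s : ℂ) : (Fin 7 → Fin 2) → ℂ :=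
  (ket ![q₁, q₂, q₃, 0, q₅, q₆, q₇]
    + ((-1 : ℂ) ^ (x₁ : ℕ)) • ket ![q₁, q₂, q₃, 0, q₅+1, q₆+1, q₇+1]
    + ((-1 : ℂ) ^ (x₂ : ℕ)) • ket ![q₁+1, q₂+1, q₃+1, 0, q₅, q₆, q₇]
    + ((-1 : ℂ) ^ (x₃ : ℕ)) • ket ![q₁+1, q₂+1, q₃+1, 0, q₅+1, q₆+1, q₇+1])
  + s • (ket ![q₁, q₂, q₃, 1, q₅, q₆, q₇]
    + ((-1 : ℂ) ^ (x₁ : ℕ)) • ket ![q₁, q₂, q₃, 1, q₅+1, q₆+1, q₇+1]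
    + ((-1 : ℂ) ^ (x₂ : ℕ)) • ket ![q₁+1, q₂+1, q₃+1, 1, q₅, q₆, q₇]
    + ((-1 : ℂ) ^ (x₃ : ℕ)) • ket ![q₁+1, q₂+1, q₃+1, 1, q₅+1, q₆+1, q₇+1])

/-- A tensor product of operators, each sending a basis vector to a multiple of a basis vector,
does the same on bit strings. -/
theorem tens_mulVec_ket {n : ℕ} (M : Fin n → Matrix (Fin 2) (Fin 2) ℂ) (q q' : Fin n → Fin 2)
    (a : Fin n → ℂ) (h : ∀ m r, M m r (q m) = if r = q' m then a m else 0) :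
    (tens M).mulVec (ket q) = (∏ m, a m) • ket q' := by
  ext r
  simp only [Matrix.mulVec, dotProduct, tens, ket, Matrix.of_apply, mul_ite, mul_one, mul_zero,
    Finset.sum_ite_eq', Finset.mem_univ, if_true, Pi.smul_apply, smul_eq_mul, h]
  split_ifs with hr
  · simp [hr]
  · obtain ⟨m, hm⟩ := Function.ne_iff.mp hr
    exact Finset.prod_eq_zero (Finset.mem_univ m) (if_neg hm)

theorem Pg_apply (i r q : Fin 2) :
    Pg i r q = if r = q + 1 then Complex.I ^ (i : ℕ) * (-1) ^ ((i : ℕ) * (q : ℕ)) else 0 := by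
  revert i r q
  simp [Fin.forall_fin_two, Pg, Xg, Yg]

theorem Xg_apply (r q : Fin 2) : Xg r q = if r = q + 1 then 1 else 0 := by
  revert r q
  simp [Fin.forall_fin_two, Xg]

theorem tens_Pg_mulVec_ket (i j k a b c d e f g : Fin 2) :
    (tens ![Pg i, Pg j, Pg k, Xg, 1, 1, 1]).mulVec (ket ![a, b, c, d, e, f, g]) =
      (Complex.I ^ ((i : ℕ) + (j : ℕ) + (k : ℕ)) *
        (-1 : ℂ) ^ ((i : ℕ) * (a : ℕ) + (j : ℕ) * (b : ℕ) + (k : ℕ) * (c : ℕ))) •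
        ket ![a + 1, b + 1, c + 1, d + 1, e, f, g] := by
  rw [tens_mulVec_ket _ _ ![a + 1, b + 1, c + 1, d + 1, e, f, g]
    ![Complex.I ^ (i : ℕ) * (-1) ^ ((i : ℕ) * (a : ℕ)),
      Complex.I ^ (j : ℕ) * (-1) ^ ((j : ℕ) * (b : ℕ)),
      Complex.I ^ (k : ℕ) * (-1) ^ ((k : ℕ) * (c : ℕ)), 1, 1, 1, 1]]
  · congr 1
    simp only [Fin.prod_univ_seven, Matrix.cons_val, pow_add]
    ring
  · intro m r
    fin_cases m
    exacts [Pg_apply i r a, Pg_apply j r b, Pg_apply k r c, Xg_apply r d,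
      Matrix.one_apply, Matrix.one_apply, Matrix.one_apply]

theorem neg_one_pow_mul_add_one (i q : Fin 2) :
    (-1 : ℂ) ^ ((i : ℕ) * ((q + 1 : Fin 2) : ℕ)) =
      (-1) ^ (i : ℕ) * (-1) ^ ((i : ℕ) * (q : ℕ)) := by
  revert i q
  simp [Fin.forall_fin_two]

/-- The phase `(-1) ^ (i q₁ + j q₂ + k q₃)` is invariant under complementing the bits `q`
when `i + j + k` is even. -/
theorem phase_compl {i j k : Fin 2} (h : Even ((i : ℕ) + (j : ℕ) + (k : ℕ))) (a b c : Fin 2) :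
    (-1 : ℂ) ^ ((i : ℕ) * ((a + 1 : Fin 2) : ℕ) + (j : ℕ) * ((b + 1 : Fin 2) : ℕ)
        + (k : ℕ) * ((c + 1 : Fin 2) : ℕ)) =
      (-1) ^ ((i : ℕ) * (a : ℕ) + (j : ℕ) * (b : ℕ) + (k : ℕ) * (c : ℕ)) := by
  have h1 : (-1 : ℂ) ^ ((i : ℕ) + (j : ℕ) + (k : ℕ)) = 1 := h.neg_one_pow
  simp only [pow_add, neg_one_pow_mul_add_one] at h1 ⊢
  linear_combination (-1) ^ ((i : ℕ) * (a : ℕ)) * (-1) ^ ((j : ℕ) * (b : ℕ))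
    * (-1) ^ ((k : ℕ) * (c : ℕ)) * h1

theorem Fin.two_add_one_add_one (q : Fin 2) : q + 1 + 1 = q := by
  fin_cases q <;> rfl

theorem stmt5 (q₁ q₂ q₃ q₅ q₆ q₇ x₁ x₂ x₃ : Fin 2)
    (hx : Even ((x₁ : ℕ) + (x₂ : ℕ) + (x₃ : ℕ)))
    (s : ℂ) (hs : s = 1 ∨ s = -1)
    (i j k : Fin 2) (heven : Even ((i : ℕ) + (j : ℕ) + (k : ℕ))) :
    (tens ![Pg i, Pg j, Pg k, Xg, 1, 1, 1]).mulVec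
      (vx q₁ q₂ q₃ q₅ q₆ q₇ x₁ x₂ x₃ s) =
      (s * (-1 : ℂ) ^ (x₂ : ℕ) * Complex.I ^ ((i : ℕ) + (j : ℕ) + (k : ℕ)) *
        (-1 : ℂ) ^ ((i : ℕ) * (q₁ : ℕ) + (j : ℕ) * (q₂ : ℕ) + (k : ℕ) * (q₃ : ℕ))) •
        vx q₁ q₂ q₃ q₅ q₆ q₇ x₁ x₂ x₃ s := by
  have hs2 : s * s = 1 := by rcases hs with rfl | rfl <;> norm_num
  have h2 : (-1 : ℂ) ^ (x₂ : ℕ) * (-1) ^ (x₂ : ℕ) = 1 := by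
    rw [← mul_pow]; norm_num
  have h3 : (-1 : ℂ) ^ (x₃ : ℕ) * (-1) ^ (x₃ : ℕ) = 1 := by
    rw [← mul_pow]; norm_num
  have h123 : (-1 : ℂ) ^ ((x₁ : ℕ) + (x₂ : ℕ) + (x₃ : ℕ)) = 1 := hx.neg_one_pow
  rw [pow_add, pow_add] at h123
  have h1 : (-1 : ℂ) ^ (x₁ : ℕ) = (-1) ^ (x₂ : ℕ) * (-1) ^ (x₃ : ℕ) := by
    linear_combination (-1 : ℂ) ^ (x₂ : ℕ) * (-1) ^ (x₃ : ℕ) * h123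
      - (-1 : ℂ) ^ (x₁ : ℕ) * (-1) ^ (x₃ : ℕ) * (-1) ^ (x₃ : ℕ) * h2 - (-1 : ℂ) ^ (x₁ : ℕ) * h3
  simp only [vx, Matrix.mulVec_add, Matrix.mulVec_smul, tens_Pg_mulVec_ket, phase_compl heven,
    Fin.two_add_one_add_one, zero_add, show (1 : Fin 2) + 1 = 0 from rfl, h1]
  generalize Complex.I ^ ((i : ℕ) + (j : ℕ) + (k : ℕ)) = u
  generalize (-1 : ℂ) ^ ((i : ℕ) * (q₁ : ℕ) + (j : ℕ) * (q₂ : ℕ) + (k : ℕ) * (q₃ : ℕ)) = w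
  generalize (-1 : ℂ) ^ (x₂ : ℕ) = b at *
  generalize (-1 : ℂ) ^ (x₃ : ℕ) = c at *
  match_scalars
  all_goals grind
end
end

section
/- For all bits i,j,k ∈ {0,1} with i+j+k odd, the 5-qubit unitary W_{3y} satisfies the conjugation identity (√−1)^{i+j+k+1} · W_{3y} (Z ⊗ Z ⊗ Z^j ⊗ Z^k ⊗ I) W_{3y}† = Y ⊗ P_i ⊗ P_j ⊗ P_k ⊗ I. -/
open Matrix Complex

noncomputable section

/-- Single-qubit Hadamard gate. -/
def Hg : Matrix (Fin 2) (Fin 2) ℂ := (Real.sqrt 2)⁻¹ • !![1, 1; 1, -1]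

/-- CNOT with control `c` and target `t`, acting on `n` qubits. -/
def CNOTg {n : ℕ} (c t : Fin n) : Matrix (Fin n → Fin 2) (Fin n → Fin 2) ℂ :=
  Matrix.of fun r col => if r = Function.update col t (col t + col c) then 1 else 0

/-- W_{3y} = CNOT_{(2;1,3,4)} · H_{(2)} · Z_{(2)} · CNOT_{(2;1,5)} · H_{(2)} · CNOT_{(2,1)}. -/
def W3y : Matrix (Fin 5 → Fin 2) (Fin 5 → Fin 2) ℂ :=
  (CNOTg 1 0 * CNOTg 1 2 * CNOTg 1 3) * tens ![1, Hg, 1, 1, 1] * tens ![1, Zg, 1, 1, 1] *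
    (CNOTg 1 0 * CNOTg 1 4) * tens ![1, Hg, 1, 1, 1] * CNOTg 1 0

theorem tens_mul_tens {n : ℕ} (M N : Fin n → Matrix (Fin 2) (Fin 2) ℂ) :
    tens M * tens N = tens fun m => M m * N m := by
  ext r s
  simp only [tens, Matrix.mul_apply, Matrix.of_apply, ← Finset.prod_mul_distrib]
  rw [Finset.prod_univ_sum, Fintype.piFinset_univ]

theorem conjTranspose_tens {n : ℕ} (M : Fin n → Matrix (Fin 2) (Fin 2) ℂ) :
    (tens M)ᴴ = tens fun m => (M m)ᴴ := by
  ext r s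
  simp [tens, Matrix.conjTranspose_apply]

theorem tens_conj {n : ℕ} (U M : Fin n → Matrix (Fin 2) (Fin 2) ℂ) :
    tens U * tens M * (tens U)ᴴ = tens fun m => U m * M m * (U m)ᴴ := by
  rw [conjTranspose_tens, tens_mul_tens, tens_mul_tens]

theorem eq_update_add_iff {n : ℕ} {c t : Fin n} (h : c ≠ t) (r q : Fin n → Fin 2) :
    r = Function.update q t (q t + q c) ↔ q = Function.update r t (r t + r c) := by
  have hadd : ∀ a b : Fin 2, a + b + b = a := by decide
  constructor <;> rintro rfl <;> simp [h, hadd]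

theorem CNOTg_apply {n : ℕ} {c t : Fin n} (h : c ≠ t) (r q : Fin n → Fin 2) :
    CNOTg c t r q = if q = Function.update r t (r t + r c) then 1 else 0 :=
  if_congr (eq_update_add_iff h r q) rfl rfl

theorem CNOTg_conj_apply {n : ℕ} {c t : Fin n} (h : c ≠ t)
    (M : Matrix (Fin n → Fin 2) (Fin n → Fin 2) ℂ) (r s : Fin n → Fin 2) :
    (CNOTg c t * M * (CNOTg c t)ᴴ) r s =
      M (Function.update r t (r t + r c)) (Function.update s t (s t + s c)) := by
  simp [Matrix.mul_apply, Matrix.conjTranspose_apply, CNOTg_apply h]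

/-- Conjugation by a CNOT only affects the tensor factors of its control and target. -/
theorem CNOTg_conj_tens {n : ℕ} {c t : Fin n} (h : c ≠ t)
    {M N : Fin n → Matrix (Fin 2) (Fin 2) ℂ}
    (hct : ∀ a a' b b', M c a a' * M t (b + a) (b' + a') = N c a a' * N t b b')
    (hM : ∀ m, m ≠ c → m ≠ t → M m = N m) :
    CNOTg c t * tens M * (CNOTg c t)ᴴ = tens N := by
  ext r s
  rw [CNOTg_conj_apply h]
  simp only [tens, Matrix.of_apply]
  rw [Fintype.prod_eq_mul_prod_compl c, Fintype.prod_eq_mul_prod_compl c,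
    ← Finset.mul_prod_erase _ _ (show t ∈ ({c} : Finset (Fin n))ᶜ by simpa using h.symm),
    ← Finset.mul_prod_erase _ _ (show t ∈ ({c} : Finset (Fin n))ᶜ by simpa using h.symm),
    ← mul_assoc, ← mul_assoc]
  congr 1
  · simpa [h] using hct (r c) (s c) (r t) (s t)
  · refine Finset.prod_congr rfl fun m hm => ?_
    simp only [Finset.mem_erase, Finset.mem_compl, Finset.mem_singleton] at hm
    simp [hm.1, hM m hm.2 hm.1]

theorem diag_CNOT_rule {A : Matrix (Fin 2) (Fin 2) ℂ} (h₀ : A 0 1 = 0) (h₁ : A 1 0 = 0)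
    (a a' b b' : Fin 2) :
    A a a' * Zg (b + a) (b' + a') = (A * Zg) a a' * Zg b b' := by
  fin_cases a <;> fin_cases a' <;> fin_cases b <;> fin_cases b' <;>
    simp [Zg, Matrix.mul_apply, h₀, h₁]

theorem antidiag_CNOT_rule {A : Matrix (Fin 2) (Fin 2) ℂ} (h₀ : A 0 0 = 0) (h₁ : A 1 1 = 0)
    (j a a' b b' : Fin 2) :
    A a a' * (Zg ^ (j : ℕ)) (b + a) (b' + a') =
      (A * Zg ^ (j : ℕ)) a a' * (Xg * Zg ^ (j : ℕ)) b b' := by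
  fin_cases j <;> fin_cases a <;> fin_cases a' <;> fin_cases b <;> fin_cases b' <;>
    simp [Xg, Zg, Matrix.mul_apply, h₀, h₁]

theorem Zg_mul_Zg : Zg * Zg = 1 := by
  simp [Zg, Matrix.one_fin_two]

theorem Hg_conj (M : Matrix (Fin 2) (Fin 2) ℂ) :
    Hg * M * Hgᴴ = (2⁻¹ : ℝ) • (!![1, 1; 1, -1] * M * !![1, 1; 1, -1]) := by
  have hK : (!![1, 1; 1, -1] : Matrix (Fin 2) (Fin 2) ℂ)ᴴ = !![1, 1; 1, -1] := by
    ext a b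
    fin_cases a <;> fin_cases b <;> simp
  rw [Hg, Matrix.conjTranspose_smul, hK, star_trivial, Matrix.smul_mul, Matrix.smul_mul,
    Matrix.mul_smul, smul_smul, ← mul_inv, Real.mul_self_sqrt zero_le_two]

theorem Hg_mul_conjTranspose : Hg * Hgᴴ = 1 := by
  have h := Hg_conj 1
  rw [Matrix.mul_one] at h
  rw [h]
  ext a b
  fin_cases a <;> fin_cases b <;> norm_num [Matrix.mul_apply]

theorem Hg_conj_Zg : Hg * Zg * Hgᴴ = Xg := by
  rw [Hg_conj]
  ext a b
  fin_cases a <;> fin_cases b <;> norm_num [Zg, Xg]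

theorem conjTranspose_Zg : Zgᴴ = Zg := by
  ext a b
  fin_cases a <;> fin_cases b <;> simp [Zg]

theorem tens_conj_second (U A B C D E : Matrix (Fin 2) (Fin 2) ℂ) :
    tens ![1, U, 1, 1, 1] * tens ![A, B, C, D, E] * (tens ![1, U, 1, 1, 1])ᴴ =
      tens ![A, U * B * Uᴴ, C, D, E] := by
  rw [tens_conj]
  congr 1
  ext m : 1
  fin_cases m <;> simp

theorem Xg_mul_Zg_pow (j : Fin 2) :
    Xg * Zg ^ (j : ℕ) = (-Complex.I) ^ (j : ℕ) • Pg j := by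
  ext a b
  fin_cases j <;> fin_cases a <;> fin_cases b <;> simp [Xg, Yg, Zg, Pg]

theorem Zg_pow_eq_of_odd {i j k : Fin 2} (hodd : Odd ((i : ℕ) + (j : ℕ) + (k : ℕ))) :
    Zg ^ (k : ℕ) * Zg ^ (j : ℕ) * Zg = Zg ^ (i : ℕ) := by
  rw [← pow_add, ← pow_succ, pow_eq_pow_mod _ (show Zg ^ 2 = 1 by rw [sq, Zg_mul_Zg])]
  congr 1
  obtain ⟨m, hm⟩ := hodd
  omega

theorem tens_smul (a b c d : ℂ) (A B C D E : Matrix (Fin 2) (Fin 2) ℂ) :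
    tens ![a • A, b • B, c • C, d • D, E] = (a * b * c * d) • tens ![A, B, C, D, E] := by
  ext r s
  simp only [tens, Matrix.of_apply, Matrix.smul_apply, Fin.prod_univ_five, smul_eq_mul,
    Matrix.cons_val]
  ring

theorem W3y_conj (j k : Fin 2) :
    W3y * tens ![Zg, Zg, Zg ^ (j : ℕ), Zg ^ (k : ℕ), 1] * W3yᴴ =
      tens ![Xg * Zg, Xg * Zg ^ (k : ℕ) * Zg ^ (j : ℕ) * Zg,
        Xg * Zg ^ (j : ℕ), Xg * Zg ^ (k : ℕ), 1] := by
  have h₁ : CNOTg 1 0 * tens ![Zg, Zg, Zg ^ (j : ℕ), Zg ^ (k : ℕ), 1] * (CNOTg 1 0)ᴴ =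
      tens ![Zg, 1, Zg ^ (j : ℕ), Zg ^ (k : ℕ), 1] := by
    refine CNOTg_conj_tens (by decide) ?_ fun m h h' => ?_
    · have h := diag_CNOT_rule (A := Zg) (by simp [Zg]) (by simp [Zg])
      rw [Zg_mul_Zg] at h
      exact h
    · fin_cases m <;> simp at h h' ⊢
  have h₂ : CNOTg 1 4 * tens ![Zg, 1, Zg ^ (j : ℕ), Zg ^ (k : ℕ), 1] * (CNOTg 1 4)ᴴ =
      tens ![Zg, 1, Zg ^ (j : ℕ), Zg ^ (k : ℕ), 1] := by
    refine CNOTg_conj_tens (by decide) (fun a a' b b' => ?_) fun m _ _ => rfl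
    change (1 : Matrix (Fin 2) (Fin 2) ℂ) a a' * (1 : Matrix (Fin 2) (Fin 2) ℂ) (b + a) (b' + a') =
      (1 : Matrix (Fin 2) (Fin 2) ℂ) a a' * (1 : Matrix (Fin 2) (Fin 2) ℂ) b b'
    by_cases h : a = a' <;> simp [Matrix.one_apply, h]
  have h₃ : CNOTg 1 0 * tens ![Zg, 1, Zg ^ (j : ℕ), Zg ^ (k : ℕ), 1] * (CNOTg 1 0)ᴴ =
      tens ![Zg, Zg, Zg ^ (j : ℕ), Zg ^ (k : ℕ), 1] := by
    refine CNOTg_conj_tens (by decide) ?_ fun m h h' => ?_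
    · have h := diag_CNOT_rule (A := 1) (by simp) (by simp)
      rw [Matrix.one_mul] at h
      exact h
    · fin_cases m <;> simp at h h' ⊢
  have h₄ : CNOTg 1 3 * tens ![Zg, Xg, Zg ^ (j : ℕ), Zg ^ (k : ℕ), 1] * (CNOTg 1 3)ᴴ =
      tens ![Zg, Xg * Zg ^ (k : ℕ), Zg ^ (j : ℕ), Xg * Zg ^ (k : ℕ), 1] := by
    refine CNOTg_conj_tens (by decide) ?_ fun m h h' => ?_
    · exact antidiag_CNOT_rule (A := Xg) (by simp [Xg]) (by simp [Xg]) k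
    · fin_cases m <;> simp at h h' ⊢
  have hk : (Xg * Zg ^ (k : ℕ)) 0 0 = 0 ∧ (Xg * Zg ^ (k : ℕ)) 1 1 = 0 := by
    fin_cases k <;> simp [Xg, Zg]
  have h₅ : CNOTg 1 2 * tens ![Zg, Xg * Zg ^ (k : ℕ), Zg ^ (j : ℕ), Xg * Zg ^ (k : ℕ), 1] *
        (CNOTg 1 2)ᴴ =
      tens ![Zg, Xg * Zg ^ (k : ℕ) * Zg ^ (j : ℕ), Xg * Zg ^ (j : ℕ), Xg * Zg ^ (k : ℕ), 1] := by
    refine CNOTg_conj_tens (by decide) ?_ fun m h h' => ?_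
    · exact antidiag_CNOT_rule hk.1 hk.2 j
    · fin_cases m <;> simp at h h' ⊢
  have hkj : (Xg * Zg ^ (k : ℕ) * Zg ^ (j : ℕ)) 0 0 = 0 ∧
      (Xg * Zg ^ (k : ℕ) * Zg ^ (j : ℕ)) 1 1 = 0 := by
    fin_cases k <;> fin_cases j <;> simp [Xg, Zg]
  have h₆ : CNOTg 1 0 * tens ![Zg, Xg * Zg ^ (k : ℕ) * Zg ^ (j : ℕ), Xg * Zg ^ (j : ℕ),
        Xg * Zg ^ (k : ℕ), 1] * (CNOTg 1 0)ᴴ =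
      tens ![Xg * Zg, Xg * Zg ^ (k : ℕ) * Zg ^ (j : ℕ) * Zg, Xg * Zg ^ (j : ℕ),
        Xg * Zg ^ (k : ℕ), 1] := by
    refine CNOTg_conj_tens (by decide) ?_ fun m h h' => ?_
    · have h := antidiag_CNOT_rule hkj.1 hkj.2 1
      simp only [Fin.val_one, pow_one] at h
      exact h
    · fin_cases m <;> simp at h h' ⊢
  have conj_mul (U V A : Matrix (Fin 5 → Fin 2) (Fin 5 → Fin 2) ℂ) :
      U * V * A * (U * V)ᴴ = U * (V * A * Vᴴ) * Uᴴ := by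
    simp only [Matrix.conjTranspose_mul, Matrix.mul_assoc]
  have hZ : Zg * Zg * Zgᴴ = Zg := by
    rw [Zg_mul_Zg, Matrix.one_mul, conjTranspose_Zg]
  simp only [W3y, conj_mul, h₁, tens_conj_second, Matrix.mul_one, Hg_mul_conjTranspose, h₂, h₃,
    hZ, Hg_conj_Zg, h₄, h₅, h₆]

theorem stmt15 (i j k : Fin 2) (hodd : Odd ((i : ℕ) + (j : ℕ) + (k : ℕ))) :
    Complex.I ^ ((i : ℕ) + (j : ℕ) + (k : ℕ) + 1) •
      (W3y * tens ![Zg, Zg, Zg ^ (j : ℕ), Zg ^ (k : ℕ), 1] * W3yᴴ) =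
    tens ![Yg, Pg i, Pg j, Pg k, 1] := by
  have hXY : Xg * Zg = (-Complex.I) • Yg := by
    simpa [Pg] using Xg_mul_Zg_pow 1
  have hi : Xg * Zg ^ (k : ℕ) * Zg ^ (j : ℕ) * Zg = (-Complex.I) ^ (i : ℕ) • Pg i := by
    rw [← Xg_mul_Zg_pow, ← Zg_pow_eq_of_odd hodd, Matrix.mul_assoc Xg, Matrix.mul_assoc Xg]
  have hI : Complex.I ^ ((i : ℕ) + (j : ℕ) + (k : ℕ) + 1) *
      (-Complex.I * (-Complex.I) ^ (i : ℕ) * (-Complex.I) ^ (j : ℕ) * (-Complex.I) ^ (k : ℕ)) =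
      1 := by
    rw [← pow_succ', ← pow_add, ← pow_add,
      show (i : ℕ) + 1 + j + k = (i : ℕ) + j + k + 1 by ring, ← mul_pow]
    simp
  rw [W3y_conj, hi, hXY, Xg_mul_Zg_pow, Xg_mul_Zg_pow, tens_smul, smul_smul, hI, one_smul]
end
end
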